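/- There exists a simple polygon P in the plane, a point s in the interior of P, and three affinely independent points t, q, r such that: (i) the closed triangle T = conv{t, q, r} is entirely contained in the interior of P; (ii) every point of the interior of T belongs to P \ V_2(s), i.e., the open triangle is disjoint from the region visible from s after at most two diffuse reflections; and (iii) each of the three closed sides [t,q], [t,r], [q,r] of T is contained in the topological frontier of V_2(s). In particular, V_2(s) has a hole (is multiply connected). -/

import Mathlib

noncomputable section
open Set

/-- Points of the Euclidean plane. -/
abbrev Pt := EuclideanSpace ℝ (Fin 2)

/-- A simple polygon in the plane: a compact set with nonempty connected
interior whose topological frontier is the union of finitely many closed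
nondegenerate line segments (the edges), any two of which meet in at most a
common endpoint, each vertex lying on exactly two edges, the frontier forming
a single closed (connected) polygonal Jordan curve. -/
structure SimplePolygon where
  carrier : Set Pt
  edges : Finset (Pt × Pt)
  isCompact : IsCompact carrier
  interior_nonempty : (interior carrier).Nonempty
  interior_connected : IsConnected (interior carrier)
  edges_nondeg : ∀ e ∈ edges, e.1 ≠ e.2
  frontier_eq : frontier carrier = ⋃ e ∈ edges, segment ℝ e.1 e.2
  edges_meet : ∀ e ∈ edges, ∀ f ∈ edges, e ≠ f →
    segment ℝ e.1 e.2 ∩ segment ℝ f.1 f.2 ⊆ ({e.1, e.2} ∩ {f.1, f.2} : Set Pt)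
  vertex_deg_two : ∀ e ∈ edges, ∀ v ∈ ({e.1, e.2} : Set Pt),
    {f | f ∈ edges ∧ (v = f.1 ∨ v = f.2)}.ncard = 2
  frontier_connected : IsConnected (frontier carrier)

/-- Two points of `P` are mutually visible if the open segment joining them
lies in the interior of `P`. -/
def MutuallyVisible (P : Set Pt) (x y : Pt) : Prop :=
  x ∈ P ∧ y ∈ P ∧ openSegment ℝ x y ⊆ interior P

/-- `p` lies in the relative interior of some edge of the polygon `Q`. -/
def OnEdgeInterior (Q : SimplePolygon) (p : Pt) : Prop :=
  ∃ e ∈ Q.edges, p ∈ openSegment ℝ e.1 e.2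

/-- `Vk Q s k` : the set of points of the polygon `Q` visible from `s` after at
most `k` diffuse reflections, i.e. points `y ∈ Q` for which there are `l ≤ k`
points `c 1, …, c l` in relative interiors of edges with consecutive members of
the chain `s = c 0, c 1, …, c l, c (l+1) = y` mutually visible. -/
def Vk (Q : SimplePolygon) (s : Pt) (k : ℕ) : Set Pt :=
  {y | y ∈ Q.carrier ∧ ∃ l : ℕ, l ≤ k ∧ ∃ c : ℕ → Pt,
    c 0 = s ∧ c (l + 1) = y ∧
    (∀ i : ℕ, 1 ≤ i → i ≤ l → OnEdgeInterior Q (c i)) ∧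
    (∀ i : ℕ, i ≤ l → MutuallyVisible Q.carrier (c i) (c (i + 1)))}

section Region

variable {lo hi : ℝ → ℝ} {a b : ℝ}

/-- The region between the graphs of `lo` and `hi`. -/
def region (lo hi : ℝ → ℝ) : Set Pt := {p | lo (p 0) ≤ p 1 ∧ p 1 ≤ hi (p 0)}

theorem continuous_mk {X : Type*} [TopologicalSpace X] {f g : X → ℝ} (hf : Continuous f)
    (hg : Continuous g) : Continuous fun x => (!₂[f x, g x] : Pt) := by
  refine (PiLp.continuous_toLp 2 _).comp (continuous_pi fun i => ?_)
  fin_cases i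
  · simpa using hf
  · simpa using hg

theorem pt_eta (p : Pt) : (!₂[p 0, p 1] : Pt) = p := by
  ext i
  fin_cases i <;> rfl

theorem pt_ext {p q : Pt} (h0 : p 0 = q 0) (h1 : p 1 = q 1) : p = q := by
  ext i
  fin_cases i
  · exact h0
  · exact h1

theorem isClosed_region (hlo : Continuous lo) (hhi : Continuous hi) :
    IsClosed (region lo hi) := by
  have h₁ : IsClosed {p : Pt | lo (p 0) ≤ p 1} := isClosed_le (by fun_prop) (by fun_prop)
  have h₂ : IsClosed {p : Pt | p 1 ≤ hi (p 0)} := isClosed_le (by fun_prop) (by fun_prop)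
  exact h₁.inter h₂

theorem eventually_vertical_mem {S : Set Pt} {p : Pt} (hp : p ∈ interior S) :
    ∃ ε > 0, (!₂[p 0, p 1 + ε] : Pt) ∈ S ∧ (!₂[p 0, p 1 - ε] : Pt) ∈ S := by
  have hc : Continuous fun t : ℝ => (!₂[p 0, p 1 + t] : Pt) :=
    continuous_mk continuous_const (by fun_prop)
  have hS : S ∈ nhds (!₂[p 0, p 1 + (0 : ℝ)] : Pt) := by
    rw [add_zero, pt_eta]
    exact mem_interior_iff_mem_nhds.1 hp
  obtain ⟨ε, hε, h⟩ := Metric.mem_nhds_iff.1 (hc.continuousAt.preimage_mem_nhds hS)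
  refine ⟨ε / 2, by positivity, h (a := ε / 2) ?_, ?_⟩
  · rw [Metric.mem_ball, Real.dist_eq, sub_zero, abs_of_pos (by positivity)]
    linarith
  · rw [sub_eq_add_neg]
    refine h (a := -(ε / 2)) ?_
    rw [Metric.mem_ball, Real.dist_eq, sub_zero, abs_neg, abs_of_pos (by positivity)]
    linarith

theorem interior_region (hlo : Continuous lo) (hhi : Continuous hi) :
    interior (region lo hi) = {p | lo (p 0) < p 1 ∧ p 1 < hi (p 0)} := by
  refine subset_antisymm (fun p hp => ?_) (interior_maximal ?_ ?_)
  · obtain ⟨ε, hε, h₁, h₂⟩ := eventually_vertical_mem hp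
    have h₃ : p 1 + ε ≤ hi (p 0) := h₁.2
    have h₄ : lo (p 0) ≤ p 1 - ε := h₂.1
    exact ⟨by linarith, by linarith⟩
  · exact fun p hp => ⟨hp.1.le, hp.2.le⟩
  · have h₁ : IsOpen {p : Pt | lo (p 0) < p 1} := isOpen_lt (by fun_prop) (by fun_prop)
    have h₂ : IsOpen {p : Pt | p 1 < hi (p 0)} := isOpen_lt (by fun_prop) (by fun_prop)
    exact h₁.inter h₂

theorem frontier_region (hlo : Continuous lo) (hhi : Continuous hi) :
    frontier (region lo hi) =
      {p | lo (p 0) ≤ hi (p 0) ∧ (p 1 = hi (p 0) ∨ p 1 = lo (p 0))} := by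
  rw [(isClosed_region hlo hhi).frontier_eq, interior_region hlo hhi]
  ext p
  simp only [region, mem_sdiff, mem_ofPred_eq, not_and_or, not_lt]
  constructor
  · rintro ⟨⟨h₁, h₂⟩, h | h⟩
    · exact ⟨h₁.trans h₂, Or.inr (le_antisymm h h₁)⟩
    · exact ⟨h₁.trans h₂, Or.inl (le_antisymm h₂ h)⟩
  · rintro ⟨h₁, h | h⟩ <;> rw [h] <;> simp [h₁]

/-- The parametrization of the vertical strips of a region. -/
def regionMap (lo hi : ℝ → ℝ) (z : ℝ × ℝ) : Pt :=
  !₂[z.1, lo z.1 + z.2 * (hi z.1 - lo z.1)]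

theorem continuous_regionMap (hlo : Continuous lo) (hhi : Continuous hi) :
    Continuous (regionMap lo hi) :=
  continuous_mk continuous_fst (by fun_prop)

theorem isCompact_region (hlo : Continuous lo) (hhi : Continuous hi)
    (hle : ∀ x, lo x ≤ hi x → x ∈ Icc a b) : IsCompact (region lo hi) := by
  refine ((isCompact_Icc.prod isCompact_Icc).image
    (continuous_regionMap hlo hhi)).of_isClosed_subset (s := image _ (Icc a b ×ˢ Icc 0 1))
    (isClosed_region hlo hhi) fun p hp => ?_
  have h := hp.1.trans hp.2
  obtain h' | h' := h.eq_or_lt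
  · refine ⟨(p 0, 0), ⟨hle _ h, by simp⟩, pt_ext rfl ?_⟩
    have := hp.1
    have := hp.2
    simp only [regionMap, PiLp.toLp_apply, Matrix.cons_val_one, Matrix.cons_val_fin_one]
    linarith
  · have h₀ : 0 < hi (p 0) - lo (p 0) := sub_pos.2 h'
    refine ⟨(p 0, (p 1 - lo (p 0)) / (hi (p 0) - lo (p 0))), ⟨hle _ h, ?_, ?_⟩, pt_ext rfl ?_⟩
    · exact div_nonneg (sub_nonneg.2 hp.1) h₀.le
    · rw [div_le_one h₀]
      linarith [hp.2]
    · simp only [regionMap, PiLp.toLp_apply, Matrix.cons_val_one, Matrix.cons_val_fin_one]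
      field_simp
      ring

theorem isConnected_interior_region (hlo : Continuous lo) (hhi : Continuous hi) (hab : a < b)
    (hlt : ∀ x, lo x < hi x ↔ x ∈ Ioo a b) : IsConnected (interior (region lo hi)) := by
  have : interior (region lo hi) = image (regionMap lo hi) (Ioo a b ×ˢ Ioo 0 1) := by
    rw [interior_region hlo hhi]
    ext p
    constructor
    · rintro ⟨h₁, h₂⟩
      have h₀ : 0 < hi (p 0) - lo (p 0) := by linarith
      refine ⟨(p 0, (p 1 - lo (p 0)) / (hi (p 0) - lo (p 0))),
        ⟨(hlt _).1 (h₁.trans h₂), ?_, ?_⟩, pt_ext rfl ?_⟩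
      · exact div_pos (sub_pos.2 h₁) h₀
      · rw [div_lt_one h₀]
        linarith
      · simp only [regionMap, PiLp.toLp_apply, Matrix.cons_val_one, Matrix.cons_val_fin_one]
        field_simp
        ring
    · rintro ⟨⟨x, t⟩, ⟨hx, ht⟩, rfl⟩
      have h₀ := sub_pos.2 ((hlt x).2 hx)
      simp only [mem_Ioo] at ht
      simp only [regionMap, mem_ofPred_eq, Matrix.cons_val_zero,
        Matrix.cons_val_one, Matrix.cons_val_fin_one]
      constructor <;> nlinarith [mul_pos ht.1 h₀, mul_pos (sub_pos.2 ht.2) h₀]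
  rw [this]
  exact ((isConnected_Ioo hab).prod (isConnected_Ioo one_pos)).image _
    (continuous_regionMap hlo hhi).continuousOn

theorem isConnected_frontier_region (hlo : Continuous lo) (hhi : Continuous hi) (hab : a ≤ b)
    (hle : ∀ x, lo x ≤ hi x ↔ x ∈ Icc a b) (ha : lo a = hi a) :
    IsConnected (frontier (region lo hi)) := by
  have : frontier (region lo hi) =
      image (fun x => (!₂[x, hi x] : Pt)) (Icc a b) ∪
        image (fun x => (!₂[x, lo x] : Pt)) (Icc a b) := by
    rw [frontier_region hlo hhi]
    ext p
    constructor
    · rintro ⟨h, h' | h'⟩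
      · exact Or.inl ⟨p 0, (hle _).1 h, pt_ext rfl h'.symm⟩
      · exact Or.inr ⟨p 0, (hle _).1 h, pt_ext rfl h'.symm⟩
    · rintro (⟨x, hx, rfl⟩ | ⟨x, hx, rfl⟩)
      · exact ⟨(hle _).2 hx, Or.inl rfl⟩
      · exact ⟨(hle _).2 hx, Or.inr rfl⟩
  rw [this]
  refine IsConnected.union ⟨!₂[a, hi a], ⟨a, left_mem_Icc.2 hab, rfl⟩,
    ⟨a, left_mem_Icc.2 hab, by simp only [ha]⟩⟩ ?_ ?_
  · exact (isConnected_Icc hab).image _ (continuous_mk continuous_id hhi).continuousOn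
  · exact (isConnected_Icc hab).image _ (continuous_mk continuous_id hlo).continuousOn

end Region

section Polygon

/-- The upper boundary of the polygon. -/
def hi (x : ℝ) : ℝ :=
  if x ≤ 10 then (x + 20) / 10
  else if x ≤ 30 then 3 + 77 / 20 * (x - 10)
  else if x ≤ 31 then 80 + 132 * (x - 30)
  else if x ≤ 40 then 212 - 44 / 3 * (x - 31)
  else if x ≤ 70 then 80 - 4 / 3 * (x - 40)
  else if x ≤ 78 then 40 + 12 * (x - 70)
  else if x ≤ 100 then 136 - 38 / 11 * (x - 78)
  else 60 - 11 / 10 * (x - 100)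

/-- The lower boundary of the polygon. -/
def lo (x : ℝ) : ℝ :=
  if x ≤ 1 then -(2 / 21) * (x + 20)
  else if x ≤ 6 then -2 - 2 * (x - 1)
  else if x ≤ 10 then -12 + 3 * (x - 6)
  else if x ≤ 40 then 0
  else if x ≤ 50 then -8 * (x - 40)
  else if x ≤ 60 then -80 - 17 * (x - 50)
  else if x ≤ 75 then -250 + 47 / 3 * (x - 60)
  else -15 + 4 / 15 * (x - 75)

theorem continuous_ite_le {c : ℝ} {f g : ℝ → ℝ} (hf : Continuous f) (hg : Continuous g)
    (h : f c = g c) : Continuous fun x => if x ≤ c then f x else g x :=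
  Continuous.if_le hf hg continuous_id continuous_const fun _ hx => by
    rw [show _ = c from hx, h]

theorem continuous_hi : Continuous hi := by
  unfold hi
  repeat' refine continuous_ite_le (by fun_prop) ?_ (by norm_num)
  fun_prop

theorem continuous_lo : Continuous lo := by
  unfold lo
  repeat' refine continuous_ite_le (by fun_prop) ?_ (by norm_num)
  fun_prop

theorem lo_lt_hi {x : ℝ} (hx : x ∈ Ioo (-20) 150) : lo x < hi x := by
  obtain ⟨h₁, h₂⟩ := hx
  unfold lo hi
  split_ifs <;> linarith

theorem hi_lt_lo_of_lt {x : ℝ} (hx : x < -20) : hi x < lo x := by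
  unfold lo hi
  rw [if_pos (by linarith), if_pos (by linarith)]
  linarith

theorem hi_lt_lo_of_gt {x : ℝ} (hx : 150 < x) : hi x < lo x := by
  unfold lo hi
  repeat rw [if_neg (by linarith)]
  linarith

theorem lo_left : lo (-20) = hi (-20) := by
  norm_num [lo, hi]

theorem lo_right : lo 150 = hi 150 := by
  norm_num [lo, hi]

theorem lo_le_hi_iff (x : ℝ) : lo x ≤ hi x ↔ x ∈ Icc (-20) 150 := by
  refine ⟨fun h => ⟨?_, ?_⟩, fun h => ?_⟩
  · by_contra! hx
    exact (hi_lt_lo_of_lt hx).not_ge h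
  · by_contra! hx
    exact (hi_lt_lo_of_gt hx).not_ge h
  · obtain h₁ | h₁ := h.1.eq_or_lt
    · rw [← h₁, lo_left]
    obtain h₂ | h₂ := h.2.eq_or_lt
    · rw [h₂, lo_right]
    exact (lo_lt_hi ⟨h₁, h₂⟩).le

theorem lo_lt_hi_iff (x : ℝ) : lo x < hi x ↔ x ∈ Ioo (-20) 150 := by
  refine ⟨fun h => ?_, lo_lt_hi⟩
  obtain ⟨h₁, h₂⟩ := (lo_le_hi_iff x).1 h.le
  refine ⟨h₁.lt_of_ne ?_, h₂.lt_of_ne ?_⟩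
  · rintro rfl
    exact h.ne lo_left
  · rintro rfl
    exact h.ne lo_right

/-- The point of the plane with the given integer coordinates. -/
def pt (v : ℤ × ℤ) : Pt := !₂[(v.1 : ℝ), (v.2 : ℝ)]

@[simp] theorem pt_zero (v : ℤ × ℤ) : pt v 0 = v.1 := rfl

@[simp] theorem pt_one (v : ℤ × ℤ) : pt v 1 = v.2 := rfl

theorem pt_injective : Function.Injective pt := fun v w h => by
  have h₀ : (v.1 : ℝ) = w.1 := congrArg (fun p : Pt => p 0) h
  have h₁ : (v.2 : ℝ) = w.2 := congrArg (fun p : Pt => p 1) h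
  exact Prod.ext (by exact_mod_cast h₀) (by exact_mod_cast h₁)

theorem mem_segment_iff {a b p : Pt} (h : a 0 < b 0) :
    p ∈ segment ℝ a b ↔ a 0 ≤ p 0 ∧ p 0 ≤ b 0 ∧
      (p 1 - a 1) * (b 0 - a 0) = (b 1 - a 1) * (p 0 - a 0) := by
  have hd : 0 < b 0 - a 0 := sub_pos.2 h
  rw [segment_eq_image_lineMap]
  constructor
  · rintro ⟨t, ⟨ht₀, ht₁⟩, rfl⟩
    simp only [AffineMap.lineMap_apply, vsub_eq_sub, vadd_eq_add, PiLp.add_apply, PiLp.smul_apply,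
      PiLp.sub_apply, smul_eq_mul]
    exact ⟨by nlinarith, by nlinarith, by ring⟩
  · rintro ⟨h₁, h₂, h₃⟩
    refine ⟨(p 0 - a 0) / (b 0 - a 0),
      ⟨div_nonneg (sub_nonneg.2 h₁) hd.le, (div_le_one hd).2 (by linarith)⟩, pt_ext ?_ ?_⟩ <;>
    simp only [AffineMap.lineMap_apply, vsub_eq_sub, vadd_eq_add, PiLp.add_apply, PiLp.smul_apply,
      PiLp.sub_apply, smul_eq_mul] <;>
    field_simp <;> linarith

theorem mem_openSegment_iff {a b p : Pt} (h : a 0 < b 0) :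
    p ∈ openSegment ℝ a b ↔ a 0 < p 0 ∧ p 0 < b 0 ∧
      (p 1 - a 1) * (b 0 - a 0) = (b 1 - a 1) * (p 0 - a 0) := by
  have hd : 0 < b 0 - a 0 := sub_pos.2 h
  rw [openSegment_eq_image_lineMap]
  constructor
  · rintro ⟨t, ⟨ht₀, ht₁⟩, rfl⟩
    simp only [AffineMap.lineMap_apply, vsub_eq_sub, vadd_eq_add, PiLp.add_apply, PiLp.smul_apply,
      PiLp.sub_apply, smul_eq_mul]
    exact ⟨by nlinarith, by nlinarith, by ring⟩
  · rintro ⟨h₁, h₂, h₃⟩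
    refine ⟨(p 0 - a 0) / (b 0 - a 0),
      ⟨div_pos (sub_pos.2 h₁) hd, (div_lt_one hd).2 (by linarith)⟩, pt_ext ?_ ?_⟩ <;>
    simp only [AffineMap.lineMap_apply, vsub_eq_sub, vadd_eq_add, PiLp.add_apply, PiLp.smul_apply,
      PiLp.sub_apply, smul_eq_mul] <;>
    field_simp <;> linarith

/-- The edges on the upper boundary, oriented from left to right. -/
def upperEdges : Finset ((ℤ × ℤ) × (ℤ × ℤ)) :=
  {((-20, 0), (10, 3)), ((10, 3), (30, 80)), ((30, 80), (31, 212)), ((31, 212), (40, 80)),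
    ((40, 80), (70, 40)), ((70, 40), (78, 136)), ((78, 136), (100, 60)), ((100, 60), (150, 5))}

/-- The edges on the lower boundary, oriented from left to right. -/
def lowerEdges : Finset ((ℤ × ℤ) × (ℤ × ℤ)) :=
  {((-20, 0), (1, -2)), ((1, -2), (6, -12)), ((6, -12), (10, 0)), ((10, 0), (40, 0)),
    ((40, 0), (50, -80)), ((50, -80), (60, -250)), ((60, -250), (75, -15)), ((75, -15), (150, 5))}

theorem edge_lt : ∀ e ∈ upperEdges ∪ lowerEdges, e.1.1 < e.2.1 := by
  decide

theorem edge_bounds : ∀ e ∈ upperEdges ∪ lowerEdges, -20 ≤ e.1.1 ∧ e.2.1 ≤ 150 := by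
  decide

theorem edge_chain :
    (∀ e ∈ upperEdges, ∀ f ∈ upperEdges,
      e = f ∨ (e.2.1 < f.1.1 ∨ e.2 = f.1) ∨ (f.2.1 < e.1.1 ∨ f.2 = e.1)) ∧
    (∀ e ∈ lowerEdges, ∀ f ∈ lowerEdges,
      e = f ∨ (e.2.1 < f.1.1 ∨ e.2 = f.1) ∨ (f.2.1 < e.1.1 ∨ f.2 = e.1)) := by
  decide

theorem edge_degree : ∀ e ∈ upperEdges ∪ lowerEdges, ∀ v, v = e.1 ∨ v = e.2 →
    ((upperEdges ∪ lowerEdges).filter fun f => v = f.1 ∨ v = f.2).card = 2 := by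
  have h : ∀ e ∈ upperEdges ∪ lowerEdges,
      ((upperEdges ∪ lowerEdges).filter fun f => e.1 = f.1 ∨ e.1 = f.2).card = 2 ∧
      ((upperEdges ∪ lowerEdges).filter fun f => e.2 = f.1 ∨ e.2 = f.2).card = 2 := by
    decide
  rintro e he v (rfl | rfl)
  · exact (h e he).1
  · exact (h e he).2

theorem mem_edge_iff {e : (ℤ × ℤ) × (ℤ × ℤ)} (he : e ∈ upperEdges ∪ lowerEdges) {p : Pt} :
    p ∈ segment ℝ (pt e.1) (pt e.2) ↔ (e.1.1 : ℝ) ≤ p 0 ∧ p 0 ≤ e.2.1 ∧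
      (p 1 - e.1.2) * (e.2.1 - e.1.1) = (e.2.2 - e.1.2) * (p 0 - e.1.1) :=
  mem_segment_iff (by simpa using edge_lt e he)

theorem exists_upper_iff (p : Pt) :
    (∃ e ∈ upperEdges, p ∈ segment ℝ (pt e.1) (pt e.2)) ↔
      p 0 ∈ Icc (-20) 150 ∧ p 1 = hi (p 0) := by
  constructor
  · rintro ⟨e, he, hp⟩
    rw [mem_edge_iff (Finset.mem_union_left _ he)] at hp
    fin_cases he <;> norm_num at hp <;> unfold hi <;>
      refine ⟨⟨by linarith, by linarith⟩, ?_⟩ <;> split_ifs <;> linarith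
  · rintro ⟨⟨h₁, h₂⟩, h⟩
    have key : ∀ e ∈ upperEdges, (e.1.1 : ℝ) ≤ p 0 ∧ p 0 ≤ e.2.1 ∧
        (p 1 - e.1.2) * (e.2.1 - e.1.1) = (e.2.2 - e.1.2) * (p 0 - e.1.1) →
        ∃ e ∈ upperEdges, p ∈ segment ℝ (pt e.1) (pt e.2) := fun e he h =>
      ⟨e, he, (mem_edge_iff (Finset.mem_union_left _ he)).2 h⟩
    unfold hi at h
    split_ifs at h
    · exact key ((-20, 0), (10, 3)) (by decide) (by norm_num; grind)
    · exact key ((10, 3), (30, 80)) (by decide) (by norm_num; grind)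
    · exact key ((30, 80), (31, 212)) (by decide) (by norm_num; grind)
    · exact key ((31, 212), (40, 80)) (by decide) (by norm_num; grind)
    · exact key ((40, 80), (70, 40)) (by decide) (by norm_num; grind)
    · exact key ((70, 40), (78, 136)) (by decide) (by norm_num; grind)
    · exact key ((78, 136), (100, 60)) (by decide) (by norm_num; grind)
    · exact key ((100, 60), (150, 5)) (by decide) (by norm_num; grind)

theorem exists_lower_iff (p : Pt) :
    (∃ e ∈ lowerEdges, p ∈ segment ℝ (pt e.1) (pt e.2)) ↔
      p 0 ∈ Icc (-20) 150 ∧ p 1 = lo (p 0) := by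
  constructor
  · rintro ⟨e, he, hp⟩
    rw [mem_edge_iff (Finset.mem_union_right _ he)] at hp
    fin_cases he <;> norm_num at hp <;> unfold lo <;>
      refine ⟨⟨by linarith, by linarith⟩, ?_⟩ <;> split_ifs <;> linarith
  · rintro ⟨⟨h₁, h₂⟩, h⟩
    have key : ∀ e ∈ lowerEdges, (e.1.1 : ℝ) ≤ p 0 ∧ p 0 ≤ e.2.1 ∧
        (p 1 - e.1.2) * (e.2.1 - e.1.1) = (e.2.2 - e.1.2) * (p 0 - e.1.1) →
        ∃ e ∈ lowerEdges, p ∈ segment ℝ (pt e.1) (pt e.2) := fun e he h =>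
      ⟨e, he, (mem_edge_iff (Finset.mem_union_right _ he)).2 h⟩
    unfold lo at h
    split_ifs at h
    · exact key ((-20, 0), (1, -2)) (by decide) (by norm_num; grind)
    · exact key ((1, -2), (6, -12)) (by decide) (by norm_num; grind)
    · exact key ((6, -12), (10, 0)) (by decide) (by norm_num; grind)
    · exact key ((10, 0), (40, 0)) (by decide) (by norm_num; grind)
    · exact key ((40, 0), (50, -80)) (by decide) (by norm_num; grind)
    · exact key ((50, -80), (60, -250)) (by decide) (by norm_num; grind)
    · exact key ((60, -250), (75, -15)) (by decide) (by norm_num; grind)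
    · exact key ((75, -15), (150, 5)) (by decide) (by norm_num; grind)

theorem eq_fst_of_mem_edge {e : (ℤ × ℤ) × (ℤ × ℤ)} (he : e ∈ upperEdges ∪ lowerEdges) {p : Pt}
    (hp : p ∈ segment ℝ (pt e.1) (pt e.2)) (h : p 0 = e.1.1) : p = pt e.1 := by
  have hlt : (e.1.1 : ℝ) < e.2.1 := by exact_mod_cast edge_lt e he
  obtain ⟨-, -, h₁⟩ := (mem_edge_iff he).1 hp
  rw [h, sub_self, mul_zero, mul_eq_zero, or_iff_left (sub_pos.2 hlt).ne', sub_eq_zero] at h₁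
  exact pt_ext h h₁

theorem eq_snd_of_mem_edge {e : (ℤ × ℤ) × (ℤ × ℤ)} (he : e ∈ upperEdges ∪ lowerEdges) {p : Pt}
    (hp : p ∈ segment ℝ (pt e.1) (pt e.2)) (h : p 0 = e.2.1) : p = pt e.2 := by
  have hlt : (e.1.1 : ℝ) < e.2.1 := by exact_mod_cast edge_lt e he
  obtain ⟨-, -, h₁⟩ := (mem_edge_iff he).1 hp
  rw [h] at h₁
  exact pt_ext h (by simpa using mul_right_cancel₀ (sub_pos.2 hlt).ne' h₁)

theorem eq_of_mem_consecutive {e f : (ℤ × ℤ) × (ℤ × ℤ)} (he : e ∈ upperEdges ∪ lowerEdges)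
    (hf : f ∈ upperEdges ∪ lowerEdges) (hef : e.2.1 < f.1.1 ∨ e.2 = f.1) {p : Pt}
    (hpe : p ∈ segment ℝ (pt e.1) (pt e.2)) (hpf : p ∈ segment ℝ (pt f.1) (pt f.2)) :
    p = pt e.2 ∧ p = pt f.1 := by
  have h₁ := ((mem_edge_iff he).1 hpe).2.1
  have h₂ := ((mem_edge_iff hf).1 hpf).1
  obtain hef | hef := hef
  · have : (e.2.1 : ℝ) < f.1.1 := by exact_mod_cast hef
    linarith
  · rw [← hef] at h₂
    have := eq_snd_of_mem_edge he hpe (le_antisymm h₁ h₂)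
    exact ⟨this, hef ▸ this⟩

theorem eq_of_mem_upper_lower {e f : (ℤ × ℤ) × (ℤ × ℤ)} (he : e ∈ upperEdges)
    (hf : f ∈ lowerEdges) {p : Pt} (hpe : p ∈ segment ℝ (pt e.1) (pt e.2))
    (hpf : p ∈ segment ℝ (pt f.1) (pt f.2)) :
    p = pt e.1 ∧ p = pt f.1 ∨ p = pt e.2 ∧ p = pt f.2 := by
  obtain ⟨⟨h₁, h₂⟩, hu⟩ := (exists_upper_iff p).1 ⟨e, he, hpe⟩
  obtain ⟨-, hl⟩ := (exists_lower_iff p).1 ⟨f, hf, hpf⟩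
  have left : ∀ g ∈ upperEdges ∪ lowerEdges, p ∈ segment ℝ (pt g.1) (pt g.2) → p 0 = -20 →
      p = pt g.1 := fun g hg hpg h => by
    refine eq_fst_of_mem_edge hg hpg (le_antisymm ?_ ((mem_edge_iff hg).1 hpg).1)
    have : ((-20 : ℤ) : ℝ) ≤ g.1.1 := Int.cast_le.2 (edge_bounds g hg).1
    push_cast at this
    linarith
  have right : ∀ g ∈ upperEdges ∪ lowerEdges, p ∈ segment ℝ (pt g.1) (pt g.2) → p 0 = 150 →
      p = pt g.2 := fun g hg hpg h => by
    refine eq_snd_of_mem_edge hg hpg (le_antisymm ((mem_edge_iff hg).1 hpg).2.1 ?_)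
    have : (g.2.1 : ℝ) ≤ (150 : ℤ) := Int.cast_le.2 (edge_bounds g hg).2
    push_cast at this
    linarith
  have heU := Finset.mem_union_left lowerEdges he
  have hfU := Finset.mem_union_right upperEdges hf
  obtain h₁ | h₁ := h₁.eq_or_lt
  · exact Or.inl ⟨left e heU hpe h₁.symm, left f hfU hpf h₁.symm⟩
  obtain h₂ | h₂ := h₂.eq_or_lt
  · exact Or.inr ⟨right e heU hpe h₂, right f hfU hpf h₂⟩
  exact absurd (hl.symm.trans hu) (lo_lt_hi ⟨h₁, h₂⟩).ne

theorem edge_inter {e f : (ℤ × ℤ) × (ℤ × ℤ)} (he : e ∈ upperEdges ∪ lowerEdges)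
    (hf : f ∈ upperEdges ∪ lowerEdges) (hef : e ≠ f) {p : Pt}
    (hpe : p ∈ segment ℝ (pt e.1) (pt e.2)) (hpf : p ∈ segment ℝ (pt f.1) (pt f.2)) :
    (p = pt e.1 ∨ p = pt e.2) ∧ (p = pt f.1 ∨ p = pt f.2) := by
  have chain (h : e = f ∨ (e.2.1 < f.1.1 ∨ e.2 = f.1) ∨ (f.2.1 < e.1.1 ∨ f.2 = e.1)) :
      (p = pt e.1 ∨ p = pt e.2) ∧ (p = pt f.1 ∨ p = pt f.2) := by
    obtain h | h | h := h
    · exact absurd h hef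
    · exact (eq_of_mem_consecutive he hf h hpe hpf).imp Or.inr Or.inl
    · exact (eq_of_mem_consecutive hf he h hpf hpe).symm.imp Or.inl Or.inr
  obtain he' | he' := Finset.mem_union.1 he <;> obtain hf' | hf' := Finset.mem_union.1 hf
  · exact chain (edge_chain.1 e he' f hf')
  · have := eq_of_mem_upper_lower he' hf' hpe hpf
    tauto
  · have := eq_of_mem_upper_lower hf' he' hpf hpe
    tauto
  · exact chain (edge_chain.2 e he' f hf')

/-- The embedding of integral segments into real ones. -/
def edgeEmb : (ℤ × ℤ) × (ℤ × ℤ) ↪ Pt × Pt :=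
  ⟨Prod.map pt pt, pt_injective.prodMap pt_injective⟩

/-- The polygon with sixteen edges bounded by the graphs of `lo` and `hi`. -/
def poly : SimplePolygon where
  carrier := region lo hi
  edges := (upperEdges ∪ lowerEdges).map edgeEmb
  isCompact := isCompact_region continuous_lo continuous_hi fun x => (lo_le_hi_iff x).1
  interior_nonempty :=
    (isConnected_interior_region continuous_lo continuous_hi (by norm_num) lo_lt_hi_iff).nonempty
  interior_connected :=
    isConnected_interior_region continuous_lo continuous_hi (by norm_num) lo_lt_hi_iff
  edges_nondeg := by
    intro e' he'
    obtain ⟨e, he, rfl⟩ := Finset.mem_map.1 he'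
    exact fun h => (edge_lt e he).ne (congrArg Prod.fst (pt_injective h))
  frontier_eq := by
    rw [frontier_region continuous_lo continuous_hi]
    ext p
    have h := or_congr (exists_upper_iff p) (exists_lower_iff p)
    rw [← and_or_left, ← lo_le_hi_iff] at h
    refine h.symm.trans ?_
    simp only [mem_iUnion, Finset.mem_map, Finset.mem_union]
    constructor
    · rintro (⟨e, he, hp⟩ | ⟨e, he, hp⟩)
      · exact ⟨edgeEmb e, ⟨e, Or.inl he, rfl⟩, hp⟩
      · exact ⟨edgeEmb e, ⟨e, Or.inr he, rfl⟩, hp⟩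
    · rintro ⟨_, ⟨e, he | he, rfl⟩, hp⟩
      · exact Or.inl ⟨e, he, hp⟩
      · exact Or.inr ⟨e, he, hp⟩
  edges_meet := by
    intro e' he' f' hf' hef p hp
    obtain ⟨e, he, rfl⟩ := Finset.mem_map.1 he'
    obtain ⟨f, hf, rfl⟩ := Finset.mem_map.1 hf'
    exact edge_inter he hf (fun h => hef (congrArg edgeEmb h)) hp.1 hp.2
  vertex_deg_two := by
    intro e' he' v hv
    obtain ⟨e, he, rfl⟩ := Finset.mem_map.1 he'
    obtain ⟨w, hw, rfl⟩ : ∃ w, (w = e.1 ∨ w = e.2) ∧ pt w = v := by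
      obtain rfl | rfl := hv
      · exact ⟨e.1, Or.inl rfl, rfl⟩
      · exact ⟨e.2, Or.inr rfl, rfl⟩
    rw [← edge_degree e he w hw, ← Set.ncard_coe_finset, ← Set.ncard_image_of_injective _
      edgeEmb.injective]
    congr 1
    ext f
    simp only [Finset.mem_map, mem_image, Finset.coe_filter]
    constructor
    · rintro ⟨⟨f, hf, rfl⟩, h⟩
      exact ⟨f, ⟨hf, h.imp (fun h => pt_injective h) fun h => pt_injective h⟩, rfl⟩
    · rintro ⟨f, ⟨hf, h⟩, rfl⟩
      exact ⟨⟨f, hf, rfl⟩, h.imp (congrArg pt) (congrArg pt)⟩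
  frontier_connected :=
    isConnected_frontier_region continuous_lo continuous_hi (by norm_num) lo_le_hi_iff lo_left

end Polygon

section Visibility

variable {p w : Pt} {v m c : ℝ}

theorem interior_poly : interior poly.carrier = {p | lo (p 0) < p 1 ∧ p 1 < hi (p 0)} :=
  interior_region continuous_lo continuous_hi

theorem MutuallyVisible.symm {P : Set Pt} (h : MutuallyVisible P p w) : MutuallyVisible P w p :=
  ⟨h.2.1, h.1, openSegment_symm ℝ p w ▸ h.2.2⟩

theorem MutuallyVisible.exists_between (h : MutuallyVisible poly.carrier p w) (h₁ : p 0 < v)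
    (h₂ : v < w 0) : ∃ y, lo v < y ∧ y < hi v ∧
      (y - p 1) * (w 0 - p 0) = (w 1 - p 1) * (v - p 0) := by
  have hd : w 0 - p 0 ≠ 0 := by linarith
  have hz : (!₂[v, p 1 + (w 1 - p 1) * (v - p 0) / (w 0 - p 0)] : Pt) ∈ openSegment ℝ p w := by
    refine (mem_openSegment_iff (h₁.trans h₂)).2 ⟨h₁, h₂, ?_⟩
    simp only [Matrix.cons_val_zero, Matrix.cons_val_one, Matrix.cons_val_fin_one]
    field_simp
    ring
  have := h.2.2 hz
  rw [interior_poly] at this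
  refine ⟨_, this.1, this.2, ?_⟩
  simp only [Matrix.cons_val_one, Matrix.cons_val_fin_one]
  field_simp
  ring

/-- Two points above a line through a point of the upper boundary that separates their abscissas
are not mutually visible. -/
theorem not_visible_of_hi (hv : hi v = c) (h₁ : p 0 < v) (h₂ : v < w 0)
    (hp : c + m * (p 0 - v) ≤ p 1) (hw : c + m * (w 0 - v) ≤ w 1) :
    ¬ MutuallyVisible poly.carrier p w := by
  intro h
  obtain ⟨y, -, hy, h'⟩ := h.exists_between h₁ h₂
  rw [hv] at hy
  nlinarith [mul_le_mul_of_nonneg_right hp (sub_pos.2 h₂).le,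
    mul_le_mul_of_nonneg_right hw (sub_pos.2 h₁).le,
    mul_pos (sub_pos.2 hy) (sub_pos.2 (h₁.trans h₂))]

/-- Two points below a line through a point of the lower boundary that separates their abscissas
are not mutually visible. -/
theorem not_visible_of_lo (hv : lo v = c) (h₁ : p 0 < v) (h₂ : v < w 0)
    (hp : p 1 ≤ c + m * (p 0 - v)) (hw : w 1 ≤ c + m * (w 0 - v)) :
    ¬ MutuallyVisible poly.carrier p w := by
  intro h
  obtain ⟨y, hy, -, h'⟩ := h.exists_between h₁ h₂
  rw [hv] at hy
  nlinarith [mul_le_mul_of_nonneg_right hp (sub_pos.2 h₂).le,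
    mul_le_mul_of_nonneg_right hw (sub_pos.2 h₁).le,
    mul_pos (sub_pos.2 hy) (sub_pos.2 (h₁.trans h₂))]

theorem visible_of_slope (hp : p ∈ poly.carrier) (hw : w ∈ poly.carrier) (hlt : p 0 < w 0)
    (hm : w 1 = p 1 + m * (w 0 - p 0))
    (h : ∀ x, p 0 < x → x < w 0 → lo x < p 1 + m * (x - p 0) ∧ p 1 + m * (x - p 0) < hi x) :
    MutuallyVisible poly.carrier p w := by
  refine ⟨hp, hw, fun z hz => ?_⟩
  obtain ⟨h₁, h₂, h₃⟩ := (mem_openSegment_iff hlt).1 hz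
  rw [interior_poly]
  have hz : z 1 = p 1 + m * (z 0 - p 0) := by
    rw [hm] at h₃
    have := mul_right_cancel₀ (b := w 0 - p 0) (sub_pos.2 hlt).ne'
      (show (z 1 - p 1) * _ = m * (z 0 - p 0) * _ by linarith)
    linarith
  show lo (z 0) < z 1 ∧ z 1 < hi (z 0)
  rw [hz]
  exact h _ h₁ h₂

/-- `p` lies in the relative interior of the integral segment `e`. -/
def OnEdge (e : (ℤ × ℤ) × (ℤ × ℤ)) (p : Pt) : Prop :=
  (e.1.1 : ℝ) < p 0 ∧ p 0 < e.2.1 ∧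
    p 1 = e.1.2 + (e.2.2 - e.1.2) / (e.2.1 - e.1.1) * (p 0 - e.1.1)

theorem onEdge_iff {e : (ℤ × ℤ) × (ℤ × ℤ)} (he : e ∈ upperEdges ∪ lowerEdges) :
    OnEdge e p ↔ p ∈ openSegment ℝ (pt e.1) (pt e.2) := by
  have hlt : (e.1.1 : ℝ) < e.2.1 := by exact_mod_cast edge_lt e he
  have hd := (sub_pos.2 hlt).ne'
  rw [mem_openSegment_iff hlt]
  simp only [OnEdge, pt_zero, pt_one]
  refine and_congr_right fun _ => and_congr_right fun _ => ?_
  rw [div_mul_eq_mul_div, ← sub_eq_iff_eq_add', eq_div_iff hd]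

theorem onEdgeInterior_iff :
    OnEdgeInterior poly p ↔ ∃ e ∈ upperEdges ∪ lowerEdges, OnEdge e p := by
  constructor
  · rintro ⟨_, he', hp⟩
    obtain ⟨e, he, rfl⟩ := Finset.mem_map.1 he'
    exact ⟨e, he, (onEdge_iff he).2 hp⟩
  · rintro ⟨e, he, hp⟩
    exact ⟨edgeEmb e, Finset.mem_map_of_mem _ he, (onEdge_iff he).1 hp⟩

/-- The edges not reached from the origin within one reflection. -/
def darkEdges : Finset ((ℤ × ℤ) × (ℤ × ℤ)) :=
  {((30, 80), (31, 212)), ((40, 80), (70, 40)), ((78, 136), (100, 60)),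
    ((50, -80), (60, -250)), ((60, -250), (75, -15))}

/-- The remaining edges. -/
def brightEdges : Finset ((ℤ × ℤ) × (ℤ × ℤ)) :=
  {((-20, 0), (10, 3)), ((10, 3), (30, 80)), ((31, 212), (40, 80)), ((70, 40), (78, 136)),
    ((100, 60), (150, 5)), ((-20, 0), (1, -2)), ((1, -2), (6, -12)), ((6, -12), (10, 0)),
    ((10, 0), (40, 0)), ((40, 0), (50, -80)), ((75, -15), (150, 5))}

theorem mem_dark_or_bright :
    ∀ e ∈ upperEdges ∪ lowerEdges, e ∈ darkEdges ∨ e ∈ brightEdges := by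
  decide

/-- The boundary points that can be seen from the origin. -/
def Lit (p : Pt) : Prop :=
  OnEdge ((-20, 0), (10, 3)) p ∨ OnEdge ((-20, 0), (1, -2)) p ∨ OnEdge ((6, -12), (10, 0)) p ∨
    (OnEdge ((75, -15), (150, 5)) p ∧ 0 < p 1) ∨
    (OnEdge ((100, 60), (150, 5)) p ∧ 10 * p 1 < 3 * p 0)

theorem Lit.bright (h : Lit p) : ∃ e ∈ brightEdges, OnEdge e p := by
  obtain h | h | h | ⟨h, -⟩ | ⟨h, -⟩ := h <;> exact ⟨_, by decide, h⟩

theorem lit_of_visible (hv : MutuallyVisible poly.carrier (pt (0, 0)) p)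
    (hp : OnEdgeInterior poly p) : Lit p := by
  obtain ⟨e, he, hp⟩ := onEdgeInterior_iff.1 hp
  have upper (h₁ : 10 < p 0) (h₂ : 3 * p 0 ≤ 10 * p 1) : False :=
    not_visible_of_hi (v := 10) (c := 3) (m := 3 / 10) (by norm_num [hi]) (by norm_num) h₁
      (by norm_num) (by linarith) hv
  have lower (h₁ : 10 < p 0) (h₂ : p 1 ≤ 0) : False :=
    not_visible_of_lo (v := 10) (c := 0) (m := 0) (by norm_num [lo]) (by norm_num) h₁
      (by norm_num) (by linarith) hv
  simp only [upperEdges, lowerEdges, Finset.mem_union, Finset.mem_insert,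
    Finset.mem_singleton] at he
  obtain (rfl | rfl | rfl | rfl | rfl | rfl | rfl | rfl) |
    (rfl | rfl | rfl | rfl | rfl | rfl | rfl | rfl) := he
  case inl.inl => exact Or.inl hp
  case inr.inl => exact Or.inr (Or.inl hp)
  case inr.inr.inr.inl => exact Or.inr (Or.inr (Or.inl hp))
  case inr.inr.inr.inr.inr.inr.inr.inr =>
    refine Or.inr (Or.inr (Or.inr (Or.inl ⟨hp, ?_⟩)))
    by_contra! h
    norm_num [OnEdge] at hp
    exact lower (by linarith) h
  case inl.inr.inr.inr.inr.inr.inr.inr =>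
    refine Or.inr (Or.inr (Or.inr (Or.inr ⟨hp, ?_⟩)))
    by_contra! h
    norm_num [OnEdge] at hp
    exact upper (by linarith) h
  case inr.inr.inl =>
    norm_num [OnEdge] at hp
    refine absurd hv (not_visible_of_lo (v := 1) (c := -2) (m := -2) (by norm_num [lo])
      (by norm_num) hp.1 (by norm_num) (by linarith))
  all_goals
    exfalso
    norm_num [OnEdge] at hp
    first
    | exact upper (by linarith) (by linarith)
    | exact lower (by linarith) (by linarith)

theorem bright_of_visible (hp : Lit p) (hv : MutuallyVisible poly.carrier p w)
    (hw : OnEdgeInterior poly w) : ∃ e ∈ brightEdges, OnEdge e w := by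
  obtain ⟨e, he, hw⟩ := onEdgeInterior_iff.1 hw
  refine (mem_dark_or_bright e he).elim (fun hd => ?_) fun hb => ⟨e, hb, hw⟩
  exfalso
  simp only [darkEdges, Finset.mem_insert, Finset.mem_singleton] at hd
  obtain hp | hp | hp | ⟨hp, hp'⟩ | ⟨hp, hp'⟩ := hp <;>
    obtain rfl | rfl | rfl | rfl | rfl := hd <;>
    norm_num [OnEdge] at hp hw <;>
    first
    | exact not_visible_of_hi (v := 30) (c := 80) (m := 132) (by norm_num [hi]) (by linarith)
        (by linarith) (by linarith) (by linarith) hv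
    | exact not_visible_of_hi (v := 10) (c := 3) (m := 3 / 5) (by norm_num [hi]) (by linarith)
        (by linarith) (by linarith) (by linarith) hv
    | exact not_visible_of_lo (v := 10) (c := 0) (m := 3) (by norm_num [lo]) (by linarith)
        (by linarith) (by linarith) (by linarith) hv
    | exact not_visible_of_lo (v := 40) (c := 0) (m := -1 / 5) (by norm_num [lo]) (by linarith)
        (by linarith) (by linarith) (by linarith) hv
    | exact not_visible_of_hi (v := 100) (c := 60) (m := -38 / 11) (by norm_num [hi]) (by linarith)
        (by linarith) (by linarith) (by linarith) hv.symm
    | exact not_visible_of_hi (v := 70) (c := 40) (m := -1) (by norm_num [hi]) (by linarith)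
        (by linarith) (by linarith) (by linarith) hv.symm
    | exact not_visible_of_lo (v := 75) (c := -15) (m := 2) (by norm_num [lo]) (by linarith)
        (by linarith) (by linarith) (by linarith) hv.symm

/-- The open triangle with vertices `(52, -96)`, `(56, -128)` and `(55, -140)`. -/
def openTriangle : Set Pt :=
  {y | y 1 < -8 * (y 0 - 40) ∧ -(44 / 3) * (y 0 - 40) + 80 < y 1 ∧ 12 * (y 0 - 70) + 40 < y 1}

theorem not_visible_of_below (hw : w ∈ openTriangle) (h₁ : p 0 < 40)
    (h₂ : p 1 ≤ -8 * (p 0 - 40)) : ¬ MutuallyVisible poly.carrier p w := by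
  obtain ⟨h₃, h₄, h₅⟩ := hw
  exact not_visible_of_lo (v := 40) (c := 0) (m := -8) (by norm_num [lo]) h₁ (by linarith)
    (by linarith) (by linarith)

theorem not_visible_of_bright (hw : w ∈ openTriangle) {e : (ℤ × ℤ) × (ℤ × ℤ)}
    (he : e ∈ brightEdges) (hp : OnEdge e p) : ¬ MutuallyVisible poly.carrier p w := by
  intro hv
  have below := not_visible_of_below (p := p) hw
  obtain ⟨h₁, h₂, h₃⟩ := hw
  simp only [brightEdges, Finset.mem_insert, Finset.mem_singleton] at he
  obtain rfl | rfl | rfl | rfl | rfl | rfl | rfl | rfl | rfl | rfl | rfl := he <;>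
    norm_num [OnEdge] at hp <;>
    first
    | exact below (by linarith) (by linarith) hv
    | exact not_visible_of_lo (v := 50) (c := -80) (m := -8) (by norm_num [lo]) (by linarith)
        (by linarith) (by linarith) (by linarith) hv
    | exact not_visible_of_hi (v := 40) (c := 80) (m := -44 / 3) (by norm_num [hi]) (by linarith)
        (by linarith) (by linarith) (by linarith) hv
    | exact not_visible_of_hi (v := 70) (c := 40) (m := 12) (by norm_num [hi]) (by linarith)
        (by linarith) (by linarith) (by linarith) hv.symm
    | exact not_visible_of_lo (v := 75) (c := -15) (m := 3) (by norm_num [lo]) (by linarith)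
        (by linarith) (by linarith) (by linarith) hv.symm

theorem disjoint_openTriangle (hw : w ∈ openTriangle) : w ∉ Vk poly (pt (0, 0)) 2 := by
  rintro ⟨-, l, hl, c, h₀, h₁, hedge, hvis⟩
  have h := hvis l le_rfl
  rw [h₁] at h
  have hlit (h : 1 ≤ l) : Lit (c 1) :=
    lit_of_visible (h₀ ▸ hvis 0 l.zero_le) (hedge 1 le_rfl h)
  interval_cases l
  · rw [h₀] at h
    exact not_visible_of_below hw (by norm_num) (by norm_num) h
  · obtain ⟨e, he, hp⟩ := (hlit le_rfl).bright
    exact not_visible_of_bright hw he hp h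
  · obtain ⟨e, he, hp⟩ :=
      bright_of_visible (hlit one_le_two) (hvis 1 one_le_two) (hedge 2 one_le_two le_rfl)
    exact not_visible_of_bright hw he hp h

end Visibility

section Triangle

variable {p w y : Pt}

/-- The closed triangle whose sides carry the boundary of the hole. -/
def triangle : Set Pt := convexHull ℝ {pt (55, -140), pt (52, -96), pt (56, -128)}

theorem triangle_subset : triangle ⊆
    {y | y 1 ≤ -8 * (y 0 - 40) ∧ -(44 / 3) * (y 0 - 40) + 80 ≤ y 1 ∧
      12 * (y 0 - 70) + 40 ≤ y 1} := by
  refine convexHull_min ?_ ?_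
  · rintro _ (rfl | rfl | rfl) <;> norm_num
  · rintro x ⟨h₁, h₂, h₃⟩ z ⟨h₁', h₂', h₃'⟩ a b ha hb hab
    obtain rfl : b = 1 - a := by linarith
    simp only [mem_ofPred_eq, PiLp.add_apply, PiLp.smul_apply, smul_eq_mul]
    refine ⟨?_, ?_, ?_⟩
    · linarith [mul_le_mul_of_nonneg_left h₁ ha, mul_le_mul_of_nonneg_left h₁' hb]
    · linarith [mul_le_mul_of_nonneg_left h₂ ha, mul_le_mul_of_nonneg_left h₂' hb]
    · linarith [mul_le_mul_of_nonneg_left h₃ ha, mul_le_mul_of_nonneg_left h₃' hb]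

theorem interior_triangle_subset : interior triangle ⊆ openTriangle := by
  intro p hp
  obtain ⟨ε, hε, h₁, h₂⟩ := eventually_vertical_mem hp
  have h₁ := triangle_subset h₁
  have h₂ := triangle_subset h₂
  simp only [mem_ofPred_eq, Matrix.cons_val_zero, Matrix.cons_val_one,
    Matrix.cons_val_fin_one] at h₁ h₂
  exact ⟨by linarith, by linarith, by linarith⟩

theorem triangle_subset_interior : triangle ⊆ interior poly.carrier := by
  intro p hp
  obtain ⟨h₁, h₂, h₃⟩ := triangle_subset hp
  rw [interior_poly]
  simp only [mem_ofPred_eq]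
  unfold lo hi
  constructor <;> split_ifs <;> linarith

theorem affineIndependent_triangle :
    AffineIndependent ℝ ![pt (55, -140), pt (52, -96), pt (56, -128)] := by
  rw [affineIndependent_iff_not_collinear_set, collinear_iff_of_mem (mem_insert _ _)]
  rintro ⟨v, hv⟩
  obtain ⟨a, ha⟩ := hv (pt (52, -96)) (by simp)
  obtain ⟨b, hb⟩ := hv (pt (56, -128)) (by simp)
  have ha₀ := congrArg (fun p : Pt => p 0) ha
  have ha₁ := congrArg (fun p : Pt => p 1) ha
  have hb₀ := congrArg (fun p : Pt => p 0) hb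
  have hb₁ := congrArg (fun p : Pt => p 1) hb
  norm_num at ha₀ ha₁ hb₀ hb₁
  have e₁ : a * v 0 = -3 := by linarith
  have e₂ : a * v 1 = 44 := by linarith
  have e₃ : b * v 0 = 1 := by linarith
  have e₄ : b * v 1 = 12 := by linarith
  have : (a * v 0) * (b * v 1) = (a * v 1) * (b * v 0) := by ring
  rw [e₁, e₂, e₃, e₄] at this
  norm_num at this

theorem interior_triangle_nonempty : (interior triangle).Nonempty := by
  rw [triangle, interior_convexHull_nonempty_iff_affineSpan_eq_top]
  have := affineIndependent_triangle.affineSpan_eq_top_iff_card_eq_finrank_add_one.2 (by simp)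
  rwa [Matrix.range_cons, Matrix.range_cons_cons_empty, singleton_union] at this

theorem triangle_inter_interior {V : Set Pt} (hV : Disjoint openTriangle V) (hp : p ∈ triangle) :
    p ∉ interior V := by
  intro h
  have hc : p ∈ closure (interior triangle) := by
    rw [Convex.closure_interior_eq_closure_of_nonempty_interior (𝕜 := ℝ) (s := triangle)
      (convex_convexHull ℝ _) interior_triangle_nonempty]
    exact subset_closure hp
  obtain ⟨z, hz, hz'⟩ := mem_closure_iff.1 hc _ isOpen_interior h
  exact hV.le_bot ⟨interior_triangle_subset hz', interior_subset hz⟩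

theorem mem_closure_of_vertical {S : Set Pt} {k ε : ℝ} (hε : 0 < ε)
    (h : ∀ d, 0 < d → d < ε → (!₂[p 0, p 1 + k * d] : Pt) ∈ S) : p ∈ closure S := by
  have hc : Continuous fun d : ℝ => (!₂[p 0, p 1 + k * d] : Pt) :=
    continuous_mk continuous_const (by fun_prop)
  have h₀ := hc.tendsto 0
  rw [mul_zero, add_zero, pt_eta] at h₀
  refine mem_closure_of_tendsto (h₀.mono_left nhdsWithin_le_nhds) (b := nhdsWithin 0 (Ioi 0)) ?_
  filter_upwards [Ioo_mem_nhdsGT hε] with d hd using h d hd.1 hd.2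

theorem mem_frontier_V2 {k : ℝ} (hp : p ∈ triangle)
    (h : ∀ d, 0 < d → d < 1 / 20 → (!₂[p 0, p 1 + k * d] : Pt) ∈ Vk poly (pt (0, 0)) 2) :
    p ∈ frontier (Vk poly (pt (0, 0)) 2) :=
  ⟨mem_closure_of_vertical (by norm_num) h, triangle_inter_interior
    (Set.disjoint_left.2 fun _ => disjoint_openTriangle) hp⟩

theorem mem_V2 {Q : SimplePolygon} {s : Pt} (hp : OnEdgeInterior Q p) (hw : OnEdgeInterior Q w)
    (h₁ : MutuallyVisible Q.carrier s p) (h₂ : MutuallyVisible Q.carrier p w)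
    (h₃ : MutuallyVisible Q.carrier w y) : y ∈ Vk Q s 2 := by
  refine ⟨h₃.2.1, 2, le_rfl, fun | 0 => s | 1 => p | 2 => w | _ + 3 => y, rfl, rfl, ?_, ?_⟩
  · intro i hi₁ hi₂
    interval_cases i
    · exact hp
    · exact hw
  · intro i hi
    interval_cases i
    · exact h₁
    · exact h₂
    · exact h₃

theorem mem_poly (h : lo (p 0) ≤ p 1 ∧ p 1 ≤ hi (p 0)) : p ∈ poly.carrier := h

theorem visible_low : MutuallyVisible poly.carrier (pt (0, 0)) (pt (8, -6)) := by
  refine visible_of_slope (m := -3 / 4) (mem_poly (by norm_num [lo, hi]))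
    (mem_poly (by norm_num [lo, hi])) (by norm_num) (by norm_num) fun x h₁ h₂ => ?_
  norm_num at h₁ h₂ ⊢
  unfold lo hi
  constructor <;> split_ifs <;> linarith

theorem visible_high : MutuallyVisible poly.carrier (pt (0, 0)) (pt (130, 27)) := by
  refine visible_of_slope (m := 27 / 130) (mem_poly (by norm_num [lo, hi]))
    (mem_poly (by norm_num [lo, hi])) (by norm_num) (by norm_num) fun x h₁ h₂ => ?_
  norm_num at h₁ h₂ ⊢
  unfold lo hi
  constructor <;> split_ifs <;> linarith

theorem visible_low_upper :
    MutuallyVisible poly.carrier (pt (8, -6)) (!₂[77 / 2, 102] : Pt) := by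
  refine visible_of_slope (m := 216 / 61) (mem_poly (by norm_num [lo, hi]))
    (mem_poly (by norm_num [lo, hi])) (by norm_num) (by norm_num) fun x h₁ h₂ => ?_
  norm_num at h₁ h₂ ⊢
  unfold lo hi
  constructor <;> split_ifs <;> linarith

theorem visible_high_lower :
    MutuallyVisible poly.carrier (pt (130, 27)) (pt (44, -32)) := by
  refine (visible_of_slope (m := 59 / 86) (mem_poly (by norm_num [lo, hi]))
    (mem_poly (by norm_num [lo, hi])) (by norm_num) (by norm_num) fun x h₁ h₂ => ?_).symm
  norm_num at h₁ h₂ ⊢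
  unfold lo hi
  constructor <;> split_ifs <;> linarith

theorem visible_high_upper :
    MutuallyVisible poly.carrier (pt (130, 27)) (pt (72, 64)) := by
  refine (visible_of_slope (m := -37 / 58) (mem_poly (by norm_num [lo, hi]))
    (mem_poly (by norm_num [lo, hi])) (by norm_num) (by norm_num) fun x h₁ h₂ => ?_).symm
  norm_num at h₁ h₂ ⊢
  unfold lo hi
  constructor <;> split_ifs <;> linarith

theorem onEdge_low : OnEdgeInterior poly (pt (8, -6)) :=
  onEdgeInterior_iff.2 ⟨((6, -12), (10, 0)), by decide, by norm_num [OnEdge]⟩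

theorem onEdge_high : OnEdgeInterior poly (pt (130, 27)) :=
  onEdgeInterior_iff.2 ⟨((100, 60), (150, 5)), by decide, by norm_num [OnEdge]⟩

theorem mem_frontier_of_left (hp : p ∈ triangle) (h : p 1 = -(44 / 3) * (p 0 - 40) + 80) :
    p ∈ frontier (Vk poly (pt (0, 0)) 2) := by
  refine mem_frontier_V2 (k := -(p 0 - 77 / 2)) hp fun d hd hd' => ?_
  obtain ⟨h₁, h₂, h₃⟩ := triangle_subset hp
  have hd₁ : ∀ x, 77 / 2 < x → x ≤ 56 → 0 < d * (x - 77 / 2) ∧ d * (x - 77 / 2) < 1 :=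
    fun x hx hx' => ⟨by nlinarith, by nlinarith⟩
  refine mem_V2 onEdge_low (w := !₂[77 / 2, 102])
    (onEdgeInterior_iff.2 ⟨((31, 212), (40, 80)), by decide, by norm_num [OnEdge]⟩)
    visible_low visible_low_upper (visible_of_slope (m := -(44 / 3) - d)
      (mem_poly (by norm_num [lo, hi])) (mem_poly ?_) ?_ ?_ fun x hx₁ hx₂ => ?_)
  · have := hd₁ (p 0) (by linarith) (by linarith)
    norm_num
    unfold lo hi
    constructor <;> split_ifs <;> linarith
  · norm_num
    linarith
  · norm_num
    linarith
  · norm_num at hx₁ hx₂ ⊢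
    have := hd₁ x hx₁ (by linarith)
    unfold lo hi
    constructor <;> split_ifs <;> linarith

theorem mem_frontier_of_upper (hp : p ∈ triangle) (h : p 1 = -8 * (p 0 - 40)) :
    p ∈ frontier (Vk poly (pt (0, 0)) 2) := by
  refine mem_frontier_V2 (k := p 0 - 44) hp fun d hd hd' => ?_
  obtain ⟨h₁, h₂, h₃⟩ := triangle_subset hp
  have hd₁ : ∀ x, 44 < x → x ≤ 56 → 0 < d * (x - 44) ∧ d * (x - 44) < 1 :=
    fun x hx hx' => ⟨by nlinarith, by nlinarith⟩
  refine mem_V2 onEdge_high (w := pt (44, -32))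
    (onEdgeInterior_iff.2 ⟨((40, 0), (50, -80)), by decide, by norm_num [OnEdge]⟩)
    visible_high visible_high_lower (visible_of_slope (m := -8 + d)
      (mem_poly (by norm_num [lo, hi])) (mem_poly ?_) ?_ ?_ fun x hx₁ hx₂ => ?_)
  · have := hd₁ (p 0) (by linarith) (by linarith)
    norm_num
    unfold lo hi
    constructor <;> split_ifs <;> linarith
  · norm_num
    linarith
  · norm_num
    linarith
  · norm_num at hx₁ hx₂ ⊢
    have := hd₁ x hx₁ (by linarith)
    unfold lo hi
    constructor <;> split_ifs <;> linarith

theorem mem_frontier_of_right (hp : p ∈ triangle) (h : p 1 = 12 * (p 0 - 70) + 40) :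
    p ∈ frontier (Vk poly (pt (0, 0)) 2) := by
  refine mem_frontier_V2 (k := p 0 - 72) hp fun d hd hd' => ?_
  obtain ⟨h₁, h₂, h₃⟩ := triangle_subset hp
  have hd₁ : ∀ x, 52 ≤ x → x < 72 → d * (x - 72) < 0 ∧ -1 < d * (x - 72) :=
    fun x hx hx' => ⟨by nlinarith, by nlinarith⟩
  have hd₂ := hd₁ (p 0) (by linarith) (by linarith)
  refine mem_V2 onEdge_high (w := pt (72, 64))
    (onEdgeInterior_iff.2 ⟨((70, 40), (78, 136)), by decide, by norm_num [OnEdge]⟩)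
    visible_high visible_high_upper (visible_of_slope (m := 12 + d)
      (mem_poly ?_) (mem_poly (by norm_num [lo, hi])) ?_ ?_ fun x hx₁ hx₂ => ?_).symm
  · norm_num
    unfold lo hi
    constructor <;> split_ifs <;> linarith
  · norm_num
    linarith
  · norm_num
    linarith
  · norm_num at hx₁ hx₂ ⊢
    have := hd₁ x (by linarith) hx₂
    unfold lo hi
    constructor <;> split_ifs <;> linarith

end Triangle

/-- There exist a simple polygon `P`, a point `s ∈ int P`, and affinely
independent points `t, q, r` such that the closed triangle `conv {t,q,r}` lies
in `int P`, the open triangle is contained in `P \ V₂(s)`, and each closed side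
of the triangle lies on the frontier of `V₂(s)`. -/
theorem hole_in_V2 :
    ∃ (Q : SimplePolygon) (s t q r : Pt),
      s ∈ interior Q.carrier ∧
      AffineIndependent ℝ ![t, q, r] ∧
      convexHull ℝ {t, q, r} ⊆ interior Q.carrier ∧
      interior (convexHull ℝ {t, q, r}) ⊆ Q.carrier \ Vk Q s 2 ∧
      segment ℝ t q ⊆ frontier (Vk Q s 2) ∧
      segment ℝ t r ⊆ frontier (Vk Q s 2) ∧
      segment ℝ q r ⊆ frontier (Vk Q s 2) := by
  have sub (a b : Pt) (ha : a ∈ ({pt (55, -140), pt (52, -96), pt (56, -128)} : Set Pt))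
      (hb : b ∈ ({pt (55, -140), pt (52, -96), pt (56, -128)} : Set Pt)) :
      segment ℝ a b ⊆ triangle := segment_subset_convexHull ha hb
  refine ⟨poly, pt (0, 0), pt (55, -140), pt (52, -96), pt (56, -128), ?_,
    affineIndependent_triangle, triangle_subset_interior, fun p hp => ⟨?_, ?_⟩,
    fun p hp => ?_, fun p hp => ?_, fun p hp => ?_⟩
  · rw [interior_poly]
    norm_num [lo, hi]
  · exact interior_subset (triangle_subset_interior (interior_subset hp))
  · exact disjoint_openTriangle (interior_triangle_subset hp)
  · refine mem_frontier_of_left (sub _ _ (by simp) (by simp) hp) ?_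
    rw [segment_symm, mem_segment_iff (by norm_num)] at hp
    norm_num at hp
    linarith
  · refine mem_frontier_of_right (sub _ _ (by simp) (by simp) hp) ?_
    rw [mem_segment_iff (by norm_num)] at hp
    norm_num at hp
    linarith
  · refine mem_frontier_of_upper (sub _ _ (by simp) (by simp) hp) ?_
    rw [mem_segment_iff (by norm_num)] at hp
    norm_num at hp
    linarith
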